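/- arXiv:2001.10522 — 4 statements merged into one kernel-verified Lean document; each statement's English description precedes it below -/
import Mathlib

section
/- Assume (H2): b₂⁺/e + δ₂₁⁺ < δ₂₂⁻. Then there exists R̃₀ > 0 such that for every λ ∈ (0,1) and every positive ω-periodic differentiable solution (x₁, x₂) of the λ-parametrized system, one has x₂(t) < R̃₀ for all t ∈ ℝ. -/
open Real Set

/-- `x⁺ := max_{t ∈ [0,ω]} x t`. -/
noncomputable def supC (ω : ℝ) (x : ℝ → ℝ) : ℝ := sSup (x '' Icc 0 ω)

/-- `x⁻ := min_{t ∈ [0,ω]} x t`. -/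
noncomputable def infC (ω : ℝ) (x : ℝ → ℝ) : ℝ := sInf (x '' Icc 0 ω)

/-- A continuous, ω-periodic, positive coefficient function. -/
def NiceCoef (ω : ℝ) (g : ℝ → ℝ) : Prop :=
  Continuous g ∧ Function.Periodic g ω ∧ ∀ t, 0 < g t

/-- `(x₁, x₂)` is a positive ω-periodic differentiable solution of the
λ-parametrized Nicholson-type system. -/
def IsLamSol (ω : ℝ) (δ₁₁ δ₁₂ δ₂₁ δ₂₂ c₁₁ c₁₂ c₂₁ c₂₂ b₁ b₂ τ₁ τ₂ : ℝ → ℝ)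
    (lam : ℝ) (x₁ x₂ : ℝ → ℝ) : Prop :=
  Differentiable ℝ x₁ ∧ Differentiable ℝ x₂ ∧
  Function.Periodic x₁ ω ∧ Function.Periodic x₂ ω ∧
  (∀ t, 0 < x₁ t) ∧ (∀ t, 0 < x₂ t) ∧
  (∀ t, deriv x₁ t = lam *
    (-(δ₁₁ t * x₁ t / (c₁₁ t + x₁ t))
      + b₁ t * (x₁ (t - τ₁ t) * Real.exp (-(x₁ (t - τ₁ t))))
      + δ₁₂ t * x₂ t / (c₁₂ t + x₂ t))) ∧
  (∀ t, deriv x₂ t = lam *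
    (-(δ₂₂ t * x₂ t / (c₂₂ t + x₂ t))
      + b₂ t * (x₂ (t - τ₂ t) * Real.exp (-(x₂ (t - τ₂ t))))
      + δ₂₁ t * x₁ t / (c₂₁ t + x₁ t)))

theorem nice_le_supC {ω : ℝ} {g : ℝ → ℝ} (hg : NiceCoef ω g) {t : ℝ} (ht : t ∈ Icc 0 ω) :
    g t ≤ supC ω g :=
  le_csSup (isCompact_Icc.image hg.1).bddAbove ⟨t, ht, rfl⟩

theorem infC_le_nice {ω : ℝ} {g : ℝ → ℝ} (hg : NiceCoef ω g) {t : ℝ} (ht : t ∈ Icc 0 ω) :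
    infC ω g ≤ g t :=
  csInf_le (isCompact_Icc.image hg.1).bddBelow ⟨t, ht, rfl⟩

theorem ricker_le (y : ℝ) : y * Real.exp (-y) ≤ 1 / Real.exp 1 := by
  have h := Real.add_one_le_exp (y - 1)
  have h2 : Real.exp (y - 1) * Real.exp (-y) = 1 / Real.exp 1 := by
    rw [← Real.exp_add, one_div, ← Real.exp_neg]
    congr 1
    ring
  rw [← h2]
  exact mul_le_mul_of_nonneg_right (by linarith) (Real.exp_pos _).le

/-- A priori upper bound for x₂ under (H2). -/
theorem nicholson_apriori_upper_x2
    (ω : ℝ) (hω : 0 < ω)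
    (δ₁₁ δ₁₂ δ₂₁ δ₂₂ c₁₁ c₁₂ c₂₁ c₂₂ b₁ b₂ τ₁ τ₂ : ℝ → ℝ)
    (hδ₁₁ : NiceCoef ω δ₁₁) (hδ₁₂ : NiceCoef ω δ₁₂)
    (hδ₂₁ : NiceCoef ω δ₂₁) (hδ₂₂ : NiceCoef ω δ₂₂)
    (hc₁₁ : NiceCoef ω c₁₁) (hc₁₂ : NiceCoef ω c₁₂)
    (hc₂₁ : NiceCoef ω c₂₁) (hc₂₂ : NiceCoef ω c₂₂)
    (hb₁ : NiceCoef ω b₁) (hb₂ : NiceCoef ω b₂)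
    (hτ₁ : NiceCoef ω τ₁) (hτ₂ : NiceCoef ω τ₂)
    (H2 : supC ω b₂ / Real.exp 1 + supC ω δ₂₁ < infC ω δ₂₂) :
    ∃ R₀ : ℝ, 0 < R₀ ∧
      ∀ lam ∈ Ioo (0:ℝ) 1, ∀ x₁ x₂ : ℝ → ℝ,
        IsLamSol ω δ₁₁ δ₁₂ δ₂₁ δ₂₂ c₁₁ c₁₂ c₂₁ c₂₂ b₁ b₂ τ₁ τ₂ lam x₁ x₂ →
        ∀ t : ℝ, x₂ t < R₀ := by
  have h0 : (0:ℝ) ∈ Icc 0 ω := ⟨le_refl _, hω.le⟩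
  have hB : 0 < supC ω b₂ := (hb₂.2.2 0).trans_le (nice_le_supC hb₂ h0)
  have hD : 0 < supC ω δ₂₁ := (hδ₂₁.2.2 0).trans_le (nice_le_supC hδ₂₁ h0)
  have hC : 0 < supC ω c₂₂ := (hc₂₂.2.2 0).trans_le (nice_le_supC hc₂₂ h0)
  obtain ⟨A, hA⟩ : ∃ A, A = supC ω b₂ / Real.exp 1 + supC ω δ₂₁ := ⟨_, rfl⟩
  rw [← hA] at H2
  have hApos : 0 < A := by rw [hA]; positivity
  have hmA : 0 < infC ω δ₂₂ - A := by linarith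
  refine ⟨A * supC ω c₂₂ / (infC ω δ₂₂ - A) + 1, by positivity, ?_⟩
  rintro lam ⟨hl, -⟩ x₁ x₂ ⟨-, hd, -, hp, hx₁, hx₂, -, he⟩ t
  obtain ⟨s, hs, hmax⟩ := isCompact_Icc.exists_isMaxOn ⟨0, h0⟩ hd.continuous.continuousOn
  have hglob : ∀ u, x₂ u ≤ x₂ s := by
    intro u
    obtain ⟨y, hy, hyu⟩ := hp.exists_mem_Ico₀ hω u
    rw [hyu]
    exact hmax (Ico_subset_Icc_self hy)
  have hder : deriv x₂ s = 0 :=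
    IsLocalMax.deriv_eq_zero (Filter.Eventually.of_forall hglob)
  have heq := he s
  rw [hder] at heq
  have heq2 := (mul_eq_zero.mp heq.symm).resolve_left hl.ne'
  have h1 : b₂ s * (x₂ (s - τ₂ s) * Real.exp (-(x₂ (s - τ₂ s)))) ≤ supC ω b₂ / Real.exp 1 := by
    calc _ ≤ supC ω b₂ * (1 / Real.exp 1) :=
          mul_le_mul (nice_le_supC hb₂ hs) (ricker_le _)
            (mul_nonneg (hx₂ _).le (Real.exp_pos _).le) hB.le
      _ = _ := by ring
  have h2 : δ₂₁ s * x₁ s / (c₂₁ s + x₁ s) ≤ supC ω δ₂₁ := by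
    have ha := hc₂₁.2.2 s
    have hb := hx₁ s
    rw [div_le_iff₀ (by linarith)]
    exact mul_le_mul (nice_le_supC hδ₂₁ hs) (by linarith) hb.le hD.le
  have h3 : δ₂₂ s * x₂ s / (c₂₂ s + x₂ s) ≤ A := by linarith
  have hxs := hx₂ s
  have hcs := hc₂₂.2.2 s
  rw [div_le_iff₀ (by linarith)] at h3
  have h4 := mul_le_mul_of_nonneg_right (infC_le_nice hδ₂₂ hs) hxs.le
  have h5 := mul_le_mul_of_nonneg_left (nice_le_supC hc₂₂ hs) hApos.le
  have h6 : x₂ s ≤ A * supC ω c₂₂ / (infC ω δ₂₂ - A) := by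
    rw [le_div_iff₀ hmA]
    linarith
  linarith [hglob t]
end

section
/- Assume (H1): b₁⁺/e + δ₁₂⁺ < δ₁₁⁻. Then there exists R₁ > 0 such that for every R > R₁ and every x₂ with 0 < x₂ ≤ R, one has g₁(R, x₂) ≥ g₁(R, R) > 0. -/
open Real Set

/-- The averaged first component
`g₁(x₁,x₂) = (1/ω) ∫₀^ω (δ₁₁ x₁/(c₁₁+x₁) − b₁ x₁ e^{−x₁} − δ₁₂ x₂/(c₁₂+x₂)) dt`. -/
noncomputable def gOne (ω : ℝ) (δ₁₁ δ₁₂ c₁₁ c₁₂ b₁ : ℝ → ℝ) (x₁ x₂ : ℝ) : ℝ :=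
  (1 / ω) * ∫ t in (0:ℝ)..ω,
    (δ₁₁ t * x₁ / (c₁₁ t + x₁) - b₁ t * (x₁ * Real.exp (-x₁))
      - δ₁₂ t * x₂ / (c₁₂ t + x₂))

/-- The averaged second component
`g₂(x₁,x₂) = (1/ω) ∫₀^ω (δ₂₂ x₂/(c₂₂+x₂) − b₂ x₂ e^{−x₂} − δ₂₁ x₁/(c₂₁+x₁)) dt`. -/
noncomputable def gTwo (ω : ℝ) (δ₂₁ δ₂₂ c₂₁ c₂₂ b₂ : ℝ → ℝ) (x₁ x₂ : ℝ) : ℝ :=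
  (1 / ω) * ∫ t in (0:ℝ)..ω,
    (δ₂₂ t * x₂ / (c₂₂ t + x₂) - b₂ t * (x₂ * Real.exp (-x₂))
      - δ₂₁ t * x₁ / (c₂₁ t + x₁))

theorem le_supC_aux {ω : ℝ} {x : ℝ → ℝ} (hx : Continuous x) {t : ℝ} (ht : t ∈ Icc 0 ω) :
    x t ≤ supC ω x :=
  le_csSup (isCompact_Icc.image hx).bddAbove (mem_image_of_mem x ht)

theorem infC_le_aux {ω : ℝ} {x : ℝ → ℝ} (hx : Continuous x) {t : ℝ} (ht : t ∈ Icc 0 ω) :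
    infC ω x ≤ x t :=
  csInf_le (isCompact_Icc.image hx).bddBelow (mem_image_of_mem x ht)

theorem cont_aux {ω : ℝ} {δ₁₁ δ₁₂ c₁₁ c₁₂ b₁ : ℝ → ℝ}
    (hδ₁₁ : NiceCoef ω δ₁₁) (hδ₁₂ : NiceCoef ω δ₁₂)
    (hc₁₁ : NiceCoef ω c₁₁) (hc₁₂ : NiceCoef ω c₁₂) (hb₁ : NiceCoef ω b₁)
    {x y : ℝ} (hx : 0 < x) (hy : 0 < y) :
    Continuous (fun t => δ₁₁ t * x / (c₁₁ t + x) - b₁ t * (x * Real.exp (-x))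
      - δ₁₂ t * y / (c₁₂ t + y)) := by
  have h1 := hδ₁₁.1
  have h2 := hδ₁₂.1
  have h3 := hc₁₁.1
  have h4 := hc₁₂.1
  have h5 := hb₁.1
  refine ((Continuous.div (by fun_prop) (by fun_prop) ?_).sub (by fun_prop)).sub
    (Continuous.div (by fun_prop) (by fun_prop) ?_)
  · intro t
    have := hc₁₁.2.2 t
    positivity
  · intro t
    have := hc₁₂.2.2 t
    positivity

/-- Under (H1), g₁ is positive near the upper boundary. -/
theorem gOne_positive_for_large
    (ω : ℝ) (hω : 0 < ω)
    (δ₁₁ δ₁₂ δ₂₁ δ₂₂ c₁₁ c₁₂ c₂₁ c₂₂ b₁ b₂ : ℝ → ℝ)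
    (hδ₁₁ : NiceCoef ω δ₁₁) (hδ₁₂ : NiceCoef ω δ₁₂)
    (hδ₂₁ : NiceCoef ω δ₂₁) (hδ₂₂ : NiceCoef ω δ₂₂)
    (hc₁₁ : NiceCoef ω c₁₁) (hc₁₂ : NiceCoef ω c₁₂)
    (hc₂₁ : NiceCoef ω c₂₁) (hc₂₂ : NiceCoef ω c₂₂)
    (hb₁ : NiceCoef ω b₁) (hb₂ : NiceCoef ω b₂)
    (H1 : supC ω b₁ / Real.exp 1 + supC ω δ₁₂ < infC ω δ₁₁) :
    ∃ R₁ : ℝ, 0 < R₁ ∧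
      ∀ R : ℝ, R₁ < R → ∀ x₂ : ℝ, 0 < x₂ → x₂ ≤ R →
        gOne ω δ₁₁ δ₁₂ c₁₁ c₁₂ b₁ R x₂ ≥ gOne ω δ₁₁ δ₁₂ c₁₁ c₁₂ b₁ R R ∧
        gOne ω δ₁₁ δ₁₂ c₁₁ c₁₂ b₁ R R > 0 := by
  have h0 : (0:ℝ) ∈ Icc 0 ω := ⟨le_rfl, hω.le⟩
  have hB : 0 < supC ω b₁ := (hb₁.2.2 0).trans_le (le_supC_aux hb₁.1 h0)
  have hD : 0 < supC ω δ₁₂ := (hδ₁₂.2.2 0).trans_le (le_supC_aux hδ₁₂.1 h0)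
  have hC : 0 < supC ω c₁₁ := (hc₁₁.2.2 0).trans_le (le_supC_aux hc₁₁.1 h0)
  set s := supC ω b₁ / Real.exp 1 + supC ω δ₁₂ with hs
  have hs0 : 0 < s := by positivity
  have hms : 0 < infC ω δ₁₁ - s := sub_pos.2 H1
  refine ⟨s * supC ω c₁₁ / (infC ω δ₁₁ - s), by positivity, ?_⟩
  intro R hR x₂ hx₂ hxR
  have hR0 : 0 < R := hx₂.trans_le hxR
  rw [div_lt_iff₀ hms] at hR
  have hcR := cont_aux hδ₁₁ hδ₁₂ hc₁₁ hc₁₂ hb₁ hR0 hR0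
  have hcx := cont_aux hδ₁₁ hδ₁₂ hc₁₁ hc₁₂ hb₁ hR0 hx₂
  constructor
  · unfold gOne
    refine mul_le_mul_of_nonneg_left ?_ (by positivity)
    refine intervalIntegral.integral_mono_on hω.le (hcR.intervalIntegrable _ _)
      (hcx.intervalIntegrable _ _) ?_
    intro t ht
    have hc := hc₁₂.2.2 t
    have hd := hδ₁₂.2.2 t
    have : δ₁₂ t * x₂ / (c₁₂ t + x₂) ≤ δ₁₂ t * R / (c₁₂ t + R) := by
      rw [div_le_div_iff₀ (by positivity) (by positivity)]
      nlinarith [mul_nonneg (mul_pos hd hc).le (sub_nonneg.2 hxR)]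
    linarith
  · unfold gOne
    refine mul_pos (by positivity) ?_
    refine intervalIntegral.intervalIntegral_pos_of_pos_on (hcR.intervalIntegrable _ _) ?_ hω
    intro t ht'
    have ht : t ∈ Icc 0 ω := Ioo_subset_Icc_self ht'
    have hc := hc₁₂.2.2 t
    have hd := hδ₁₂.2.2 t
    have hc1 := hc₁₁.2.2 t
    have e1 : δ₁₂ t * R / (c₁₂ t + R) ≤ supC ω δ₁₂ := by
      refine le_trans ?_ (le_supC_aux hδ₁₂.1 ht)
      rw [div_le_iff₀ (by positivity)]
      nlinarith
    have e2 : b₁ t * (R * Real.exp (-R)) ≤ supC ω b₁ / Real.exp 1 := by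
      rw [div_eq_mul_inv, ← Real.exp_neg]
      refine mul_le_mul (le_supC_aux hb₁.1 ht) ?_ (by positivity) hB.le
      have h1 : R ≤ Real.exp (R - 1) := by linarith [Real.add_one_le_exp (R - 1)]
      calc R * Real.exp (-R) ≤ Real.exp (R - 1) * Real.exp (-R) := by gcongr
        _ = Real.exp (-1) := by rw [← Real.exp_add]; ring_nf
    have e3 : s < δ₁₁ t * R / (c₁₁ t + R) := by
      rw [lt_div_iff₀ (by positivity)]
      have a1 := mul_le_mul_of_nonneg_left (le_supC_aux hc₁₁.1 ht) hs0.le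
      have a2 := mul_le_mul_of_nonneg_right (infC_le_aux hδ₁₁.1 ht) hR0.le
      nlinarith
    linarith
end

section
/- Assume (H4): δ₂₂⁺/c₂₂⁻ − δ₂₁⁻/c₂₁⁺ < b₂⁻. Then there exists ε₁ > 0 such that for every ε with 0 < ε < ε₁ and every x₁ with ε ≤ x₁, one has g₂(x₁, ε) ≤ g₂(ε, ε) < 0. -/
open Real Set

theorem NiceCoef.le_supC {ω : ℝ} {g : ℝ → ℝ} (h : NiceCoef ω g) {t : ℝ} (ht : t ∈ Icc 0 ω) :
    g t ≤ supC ω g :=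
  le_csSup (isCompact_Icc.image h.1).bddAbove (mem_image_of_mem g ht)

theorem NiceCoef.infC_le {ω : ℝ} {g : ℝ → ℝ} (h : NiceCoef ω g) {t : ℝ} (ht : t ∈ Icc 0 ω) :
    infC ω g ≤ g t :=
  csInf_le (isCompact_Icc.image h.1).bddBelow (mem_image_of_mem g ht)

theorem NiceCoef.infC_pos {ω : ℝ} (hω : 0 < ω) {g : ℝ → ℝ} (h : NiceCoef ω g) :
    0 < infC ω g := by
  have hne : (g '' Icc 0 ω).Nonempty := (nonempty_Icc.2 hω.le).image g
  obtain ⟨t, _, ht⟩ := (isCompact_Icc.image h.1).sInf_mem hne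
  unfold infC
  rw [← ht]
  exact h.2.2 t

theorem gTwo_integrable {ω : ℝ} {δ₂₁ δ₂₂ c₂₁ c₂₂ b₂ : ℝ → ℝ}
    (hδ₂₁ : NiceCoef ω δ₂₁) (hδ₂₂ : NiceCoef ω δ₂₂)
    (hc₂₁ : NiceCoef ω c₂₁) (hc₂₂ : NiceCoef ω c₂₂) (hb₂ : NiceCoef ω b₂)
    {x₁ x₂ : ℝ} (h1 : 0 < x₁) (h2 : 0 < x₂) :
    IntervalIntegrable (fun t => δ₂₂ t * x₂ / (c₂₂ t + x₂) - b₂ t * (x₂ * Real.exp (-x₂))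
      - δ₂₁ t * x₁ / (c₂₁ t + x₁)) MeasureTheory.volume 0 ω := by
  apply Continuous.intervalIntegrable
  have e1 := hδ₂₁.1
  have e2 := hδ₂₂.1
  have e3 := hc₂₁.1
  have e4 := hc₂₂.1
  have e5 := hb₂.1
  have n1 : ∀ t, c₂₁ t + x₁ ≠ 0 := fun t => (add_pos (hc₂₁.2.2 t) h1).ne'
  have n2 : ∀ t, c₂₂ t + x₂ ≠ 0 := fun t => (add_pos (hc₂₂.2.2 t) h2).ne'
  exact (((e2.mul continuous_const).div (e4.add continuous_const) n2).sub
    (e5.mul continuous_const)).sub ((e1.mul continuous_const).div (e3.add continuous_const) n1)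

/-- Under (H4), g₂ is negative near the lower boundary. -/
theorem gTwo_negative_near_zero
    (ω : ℝ) (hω : 0 < ω)
    (δ₁₁ δ₁₂ δ₂₁ δ₂₂ c₁₁ c₁₂ c₂₁ c₂₂ b₁ b₂ : ℝ → ℝ)
    (hδ₁₁ : NiceCoef ω δ₁₁) (hδ₁₂ : NiceCoef ω δ₁₂)
    (hδ₂₁ : NiceCoef ω δ₂₁) (hδ₂₂ : NiceCoef ω δ₂₂)
    (hc₁₁ : NiceCoef ω c₁₁) (hc₁₂ : NiceCoef ω c₁₂)
    (hc₂₁ : NiceCoef ω c₂₁) (hc₂₂ : NiceCoef ω c₂₂)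
    (hb₁ : NiceCoef ω b₁) (hb₂ : NiceCoef ω b₂)
    (H4 : supC ω δ₂₂ / infC ω c₂₂ - infC ω δ₂₁ / supC ω c₂₁ < infC ω b₂) :
    ∃ ε₁ : ℝ, 0 < ε₁ ∧
      ∀ ε : ℝ, 0 < ε → ε < ε₁ → ∀ x₁ : ℝ, ε ≤ x₁ →
        gTwo ω δ₂₁ δ₂₂ c₂₁ c₂₂ b₂ x₁ ε ≤ gTwo ω δ₂₁ δ₂₂ c₂₁ c₂₂ b₂ ε ε ∧
        gTwo ω δ₂₁ δ₂₂ c₂₁ c₂₂ b₂ ε ε < 0 := by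
  have hC := hc₂₂.infC_pos hω
  have hd := hδ₂₁.infC_pos hω
  have h0 : (0:ℝ) ∈ Icc 0 ω := ⟨le_rfl, hω.le⟩
  have hK : 0 < supC ω c₂₁ := (hc₂₁.2.2 0).trans_le (hc₂₁.le_supC h0)
  have hD : 0 < supC ω δ₂₂ := (hδ₂₂.2.2 0).trans_le (hδ₂₂.le_supC h0)
  have hcont : ContinuousAt (fun ε : ℝ => supC ω δ₂₂ / infC ω c₂₂ - infC ω b₂ * Real.exp (-ε)
      - infC ω δ₂₁ / (supC ω c₂₁ + ε)) 0 := by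
    refine ContinuousAt.sub (by fun_prop) (ContinuousAt.div (by fun_prop) (by fun_prop) ?_)
    simpa using hK.ne'
  have hev := hcont.eventually_lt_const (u := 0) (by simp; linarith)
  obtain ⟨ε₁, hε₁, hball⟩ := Metric.eventually_nhds_iff.1 hev
  refine ⟨ε₁, hε₁, fun ε hε hlt x₁ hx => ⟨?_, ?_⟩⟩
  · unfold gTwo
    refine mul_le_mul_of_nonneg_left ?_ (by positivity)
    refine intervalIntegral.integral_mono_on hω.le
      (gTwo_integrable hδ₂₁ hδ₂₂ hc₂₁ hc₂₂ hb₂ (hε.trans_le hx) hε)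
      (gTwo_integrable hδ₂₁ hδ₂₂ hc₂₁ hc₂₂ hb₂ hε hε) fun t _ => ?_
    have hc := hc₂₁.2.2 t
    have hδ := hδ₂₁.2.2 t
    have hx0 := hε.trans_le hx
    refine sub_le_sub_left ?_ _
    rw [div_le_div_iff₀ (by positivity) (by positivity)]
    nlinarith [mul_nonneg (mul_pos hδ hc).le (sub_nonneg.2 hx)]
  · have hneg := hball (y := ε) (by simpa [abs_of_pos hε] using hlt)
    unfold gTwo
    refine mul_neg_of_pos_of_neg (by positivity) ?_
    have hle := intervalIntegral.integral_mono_on hω.le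
      (gTwo_integrable hδ₂₁ hδ₂₂ hc₂₁ hc₂₂ hb₂ hε hε)
      (intervalIntegrable_const (c := ε * (supC ω δ₂₂ / infC ω c₂₂
        - infC ω b₂ * Real.exp (-ε) - infC ω δ₂₁ / (supC ω c₂₁ + ε)))) fun t ht => ?_
    · refine hle.trans_lt ?_
      rw [intervalIntegral.integral_const, sub_zero, smul_eq_mul]
      exact mul_neg_of_pos_of_neg hω (mul_neg_of_pos_of_neg hε hneg)
    · have hc := hc₂₁.2.2 t
      have hδ := hδ₂₁.2.2 t
      have a1 : δ₂₂ t / (c₂₂ t + ε) ≤ supC ω δ₂₂ / infC ω c₂₂ :=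
        div_le_div₀ hD.le (hδ₂₂.le_supC ht) hC (by linarith [hc₂₂.infC_le ht])
      have a2 : infC ω δ₂₁ / (supC ω c₂₁ + ε) ≤ δ₂₁ t / (c₂₁ t + ε) :=
        div_le_div₀ hδ.le (hδ₂₁.infC_le ht) (by linarith) (by linarith [hc₂₁.le_supC ht])
      have a3 : infC ω b₂ * Real.exp (-ε) ≤ b₂ t * Real.exp (-ε) :=
        mul_le_mul_of_nonneg_right (hb₂.infC_le ht) (Real.exp_pos _).le
      calc _ = ε * (δ₂₂ t / (c₂₂ t + ε) - b₂ t * Real.exp (-ε) - δ₂₁ t / (c₂₁ t + ε)) := by ring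
        _ ≤ _ := mul_le_mul_of_nonneg_left (by linarith) hε.le
end

section
/- Assume (H1), (H2), (H3) and (H4). Then there exist real numbers 0 < ε < R and a point (x̃₁, x̃₂) ∈ (ε, R) × (ε, R) such that g₁(x̃₁, x̃₂) = 0 and g₂(x̃₁, x̃₂) = 0. -/
open Real Set

lemma NiceCoef.bounds {ω : ℝ} (hω : 0 < ω) {g : ℝ → ℝ} (h : NiceCoef ω g) :
    0 < infC ω g ∧ infC ω g ≤ supC ω g ∧ ∀ t ∈ Icc 0 ω, infC ω g ≤ g t ∧ g t ≤ supC ω g := by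
  obtain ⟨hc, -, hp⟩ := h
  have hK : IsCompact (g '' Icc 0 ω) := isCompact_Icc.image hc
  have hne : (g '' Icc 0 ω).Nonempty := ⟨g 0, 0, ⟨le_refl _, hω.le⟩, rfl⟩
  have hb : ∀ t ∈ Icc 0 ω, infC ω g ≤ g t ∧ g t ≤ supC ω g := fun t ht =>
    ⟨csInf_le hK.bddBelow ⟨t, ht, rfl⟩, le_csSup hK.bddAbove ⟨t, ht, rfl⟩⟩
  refine ⟨?_, ?_, hb⟩
  · obtain ⟨t, -, ht⟩ := hK.sInf_mem hne
    unfold infC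
    rw [← ht]
    exact hp t
  · have := hb 0 ⟨le_refl _, hω.le⟩
    linarith [this.1, this.2]

lemma gOne_integrand_cont {ω : ℝ} {d e c k b : ℝ → ℝ}
    (hd : NiceCoef ω d) (he : NiceCoef ω e) (hc : NiceCoef ω c) (hk : NiceCoef ω k)
    (hb : NiceCoef ω b) :
    Continuous (fun q : (ℝ × ℝ) × ℝ => d q.2 * |q.1.1| / (c q.2 + |q.1.1|)
      - b q.2 * (|q.1.1| * Real.exp (-|q.1.1|)) - e q.2 * |q.1.2| / (k q.2 + |q.1.2|)) := by
  have h1 := hd.1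
  have h2 := he.1
  have h3 := hc.1
  have h4 := hk.1
  have h5 := hb.1
  have n1 : ∀ q : (ℝ × ℝ) × ℝ, c q.2 + |q.1.1| ≠ 0 := fun q =>
    (add_pos_of_pos_of_nonneg (hc.2.2 _) (abs_nonneg _)).ne'
  have n2 : ∀ q : (ℝ × ℝ) × ℝ, k q.2 + |q.1.2| ≠ 0 := fun q =>
    (add_pos_of_pos_of_nonneg (hk.2.2 _) (abs_nonneg _)).ne'
  refine ((Continuous.div (by fun_prop) (by fun_prop) n1).sub (by fun_prop)).sub
    (Continuous.div (by fun_prop) (by fun_prop) n2)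

lemma gOne_cont {ω : ℝ} {d e c k b : ℝ → ℝ}
    (hd : NiceCoef ω d) (he : NiceCoef ω e) (hc : NiceCoef ω c) (hk : NiceCoef ω k)
    (hb : NiceCoef ω b) :
    Continuous (fun p : ℝ × ℝ => gOne ω d e c k b |p.1| |p.2|) := by
  unfold gOne
  refine continuous_const.mul ?_
  exact intervalIntegral.continuous_parametric_intervalIntegral_of_continuous'
    (gOne_integrand_cont hd he hc hk hb) 0 ω

lemma gOne_ii {ω : ℝ} {d e c k b : ℝ → ℝ}
    (hd : NiceCoef ω d) (he : NiceCoef ω e) (hc : NiceCoef ω c) (hk : NiceCoef ω k)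
    (hb : NiceCoef ω b) {x y : ℝ} (hx : 0 ≤ x) (hy : 0 ≤ y) :
    IntervalIntegrable (fun t => d t * x / (c t + x) - b t * (x * Real.exp (-x))
      - e t * y / (k t + y)) MeasureTheory.volume 0 ω := by
  have := (gOne_integrand_cont hd he hc hk hb).comp
    (Continuous.prodMk_right (X := ℝ × ℝ) (Y := ℝ) (x, y))
  simp only [Function.comp_def, abs_of_nonneg hx, abs_of_nonneg hy] at this
  exact this.intervalIntegrable _ _

lemma gOne_anti {ω : ℝ} (hω : 0 < ω) {d e c k b : ℝ → ℝ}
    (hd : NiceCoef ω d) (he : NiceCoef ω e) (hc : NiceCoef ω c) (hk : NiceCoef ω k)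
    (hb : NiceCoef ω b) {x y z : ℝ} (hx : 0 ≤ x) (hy : 0 ≤ y) (hyz : y ≤ z) :
    gOne ω d e c k b x z ≤ gOne ω d e c k b x y := by
  unfold gOne
  refine mul_le_mul_of_nonneg_left ?_ (by positivity)
  refine intervalIntegral.integral_mono_on hω.le (gOne_ii hd he hc hk hb hx (hy.trans hyz))
    (gOne_ii hd he hc hk hb hx hy) ?_
  intro t _
  have hk' := hk.2.2 t
  have he' := he.2.2 t
  refine sub_le_sub_left ?_ _
  rw [div_le_div_iff₀ (by linarith) (by linarith)]
  nlinarith [mul_le_mul_of_nonneg_left hyz (mul_pos he' hk').le]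

lemma gOne_neg_of {ω : ℝ} (hω : 0 < ω) {d e c k b : ℝ → ℝ}
    (hd : NiceCoef ω d) (he : NiceCoef ω e) (hc : NiceCoef ω c) (hk : NiceCoef ω k)
    (hb : NiceCoef ω b) {x y M : ℝ} (hx : 0 ≤ x) (hy : 0 ≤ y) (hM : M < 0)
    (h : ∀ t ∈ Icc 0 ω, d t * x / (c t + x) - b t * (x * Real.exp (-x))
      - e t * y / (k t + y) ≤ M) : gOne ω d e c k b x y < 0 := by
  unfold gOne
  have h1 := intervalIntegral.integral_mono_on hω.le (gOne_ii hd he hc hk hb hx hy)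
    intervalIntegrable_const h
  rw [intervalIntegral.integral_const, smul_eq_mul] at h1
  refine mul_neg_of_pos_of_neg (by positivity) (lt_of_le_of_lt h1 ?_)
  nlinarith

lemma gOne_pos_of {ω : ℝ} (hω : 0 < ω) {d e c k b : ℝ → ℝ}
    (hd : NiceCoef ω d) (he : NiceCoef ω e) (hc : NiceCoef ω c) (hk : NiceCoef ω k)
    (hb : NiceCoef ω b) {x y M : ℝ} (hx : 0 ≤ x) (hy : 0 ≤ y) (hM : 0 < M)
    (h : ∀ t ∈ Icc 0 ω, M ≤ d t * x / (c t + x) - b t * (x * Real.exp (-x))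
      - e t * y / (k t + y)) : 0 < gOne ω d e c k b x y := by
  unfold gOne
  have h1 := intervalIntegral.integral_mono_on hω.le 
    intervalIntegrable_const (gOne_ii hd he hc hk hb hx hy) h
  rw [intervalIntegral.integral_const, smul_eq_mul] at h1
  refine mul_pos (by positivity) (lt_of_lt_of_le ?_ h1)
  nlinarith

lemma gOne_small {ω : ℝ} (hω : 0 < ω) {d e c k b : ℝ → ℝ}
    (hd : NiceCoef ω d) (he : NiceCoef ω e) (hc : NiceCoef ω c) (hk : NiceCoef ω k)
    (hb : NiceCoef ω b)
    (H : supC ω d / infC ω c - infC ω e / supC ω k < infC ω b) :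
    ∃ ε₀ > 0, ∀ x, 0 < x → x < ε₀ → gOne ω d e c k b x x < 0 := by
  obtain ⟨d0, d1, d2⟩ := hd.bounds hω
  obtain ⟨e0, e1, e2⟩ := he.bounds hω
  obtain ⟨c0, c1, c2⟩ := hc.bounds hω
  obtain ⟨k0, k1, k2⟩ := hk.bounds hω
  obtain ⟨b0, b1, b2⟩ := hb.bounds hω
  set D := supC ω d
  set C := infC ω c
  set E := infC ω e
  set K := supC ω k
  set B := infC ω b
  have hK : 0 < K := by linarith
  have hcont : ContinuousAt (fun x : ℝ => D / C - B * Real.exp (-x) - E / (K + x)) 0 := by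
    refine ContinuousAt.sub (by fun_prop) (ContinuousAt.div (by fun_prop) (by fun_prop) ?_)
    simpa using hK.ne'
  have hneg : (fun x : ℝ => D / C - B * Real.exp (-x) - E / (K + x)) 0 < 0 := by
    simp only [neg_zero, Real.exp_zero, add_zero]; linarith
  obtain ⟨ε₀, hε, h⟩ := Metric.eventually_nhds_iff.1 (hcont.eventually (gt_mem_nhds hneg))
  refine ⟨ε₀, hε, fun x hx hxe => ?_⟩
  have hx' := h (y := x) (by rw [Real.dist_eq, sub_zero, abs_of_pos hx]; exact hxe)
  refine gOne_neg_of hω hd he hc hk hb hx.le hx.le (mul_neg_of_pos_of_neg hx hx') ?_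
  intro t ht
  have := d2 t ht
  have := e2 t ht
  have := c2 t ht
  have := k2 t ht
  have := b2 t ht
  have q1 : d t * x / (c t + x) ≤ D * x / C := by
    apply div_le_div₀ <;> nlinarith
  have q2 : E * x / (K + x) ≤ e t * x / (k t + x) := by
    apply div_le_div₀ <;> nlinarith
  have q3 : B * (x * Real.exp (-x)) ≤ b t * (x * Real.exp (-x)) :=
    mul_le_mul_of_nonneg_right (by linarith) (by positivity)
  have : x * (D / C - B * Real.exp (-x) - E / (K + x)) =
    D * x / C - B * (x * Real.exp (-x)) - E * x / (K + x) := by ring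
  simp only [this]
  linarith

lemma gOne_large {ω : ℝ} (hω : 0 < ω) {d e c k b : ℝ → ℝ}
    (hd : NiceCoef ω d) (he : NiceCoef ω e) (hc : NiceCoef ω c) (hk : NiceCoef ω k)
    (hb : NiceCoef ω b)
    (H : supC ω b / Real.exp 1 + supC ω e < infC ω d) :
    ∃ R₀, ∀ x y, 0 < x → R₀ < x → 0 ≤ y → 0 < gOne ω d e c k b x y := by
  obtain ⟨d0, d1, d2⟩ := hd.bounds hω
  obtain ⟨e0, e1, e2⟩ := he.bounds hω
  obtain ⟨c0, c1, c2⟩ := hc.bounds hω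
  obtain ⟨k0, k1, k2⟩ := hk.bounds hω
  obtain ⟨b0, b1, b2⟩ := hb.bounds hω
  set D := infC ω d
  set C := supC ω c
  set E := supC ω e
  set B := supC ω b
  have hC : 0 < C := by linarith
  have hB : 0 < B := by linarith
  have hg : 0 < D - (B / Real.exp 1 + E) := by linarith
  refine ⟨D * C / (D - (B / Real.exp 1 + E)), fun x y hx hR hy => ?_⟩
  have hM : 0 < D * x / (C + x) - B / Real.exp 1 - E := by
    rw [div_lt_iff₀ hg] at hR
    have hp : 0 < B / Real.exp 1 + E := by
      have := div_pos hB (Real.exp_pos 1)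
      linarith
    have : B / Real.exp 1 + E < D * x / (C + x) := by
      rw [lt_div_iff₀ (by linarith)]
      nlinarith
    linarith
  refine gOne_pos_of hω hd he hc hk hb hx.le hy hM ?_
  intro t ht
  have := d2 t ht
  have := e2 t ht
  have := c2 t ht
  have := k2 t ht
  have := b2 t ht
  have q1 : D * x / (C + x) ≤ d t * x / (c t + x) := by
    apply div_le_div₀ <;> nlinarith
  have q2 : e t * y / (k t + y) ≤ E := by
    rw [div_le_iff₀ (by linarith)]
    nlinarith
  have q3 : b t * (x * Real.exp (-x)) ≤ B / Real.exp 1 := by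
    rw [div_eq_mul_inv, ← Real.exp_neg]
    have : x * Real.exp (-x) ≤ Real.exp (-1) := by
      have h := Real.add_one_le_exp (x - 1)
      have h2 : Real.exp (-1) = Real.exp (x - 1) * Real.exp (-x) := by
        rw [← Real.exp_add]; ring_nf
      rw [h2]
      exact mul_le_mul_of_nonneg_right (by linarith) (Real.exp_pos _).le
    have h0 : 0 ≤ x * Real.exp (-x) := by positivity
    exact mul_le_mul (by linarith) this h0 hB.le
  linarith

/-- A two-dimensional zero theorem for quasimonotone maps: a point maximizing `x + y` on
the set where both components are nonpositive is a zero. -/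
lemma quasimonotone_zero (f g : ℝ × ℝ → ℝ) (hf : Continuous f) (hg : Continuous g)
    (ε R : ℝ) (h : ε < R)
    (fa : ∀ x y z, ε ≤ x → ε ≤ y → y ≤ z → f (x, z) ≤ f (x, y))
    (ga : ∀ x y z, ε ≤ x → ε ≤ y → y ≤ z → g (z, x) ≤ g (y, x))
    (f0 : f (ε, ε) ≤ 0) (g0 : g (ε, ε) ≤ 0)
    (fR : ∀ y, ε ≤ y → 0 < f (R, y)) (gR : ∀ x, ε ≤ x → 0 < g (x, R)) :
    ∃ x y, ε ≤ x ∧ x < R ∧ ε ≤ y ∧ y < R ∧ f (x, y) = 0 ∧ g (x, y) = 0 := by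
  have hS : IsCompact ((Icc ε R ×ˢ Icc ε R) ∩ {p | f p ≤ 0 ∧ g p ≤ 0}) :=
    (isCompact_Icc.prod isCompact_Icc).inter_right
      ((isClosed_le hf continuous_const).inter (isClosed_le hg continuous_const))
  obtain ⟨⟨x, y⟩, ⟨⟨⟨hx1, hx2⟩, ⟨hy1, hy2⟩⟩, hfm, hgm⟩, hmax⟩ := hS.exists_isMaxOn
    ⟨(ε, ε), ⟨⟨⟨le_refl _, h.le⟩, ⟨le_refl _, h.le⟩⟩, f0, g0⟩⟩
    (f := fun p : ℝ × ℝ => p.1 + p.2) (by fun_prop)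
  simp only at hx1 hx2 hy1 hy2
  have hxR : x < R := lt_of_le_of_ne hx2 (by rintro rfl; linarith [fR y hy1])
  have hyR : y < R := lt_of_le_of_ne hy2 (by rintro rfl; linarith [gR x hx1])
  refine ⟨x, y, hx1, hxR, hy1, hyR, ?_, ?_⟩
  · by_contra hne
    have hlt : f (x, y) < 0 := lt_of_le_of_ne hfm hne
    have hc : Continuous (fun s => f (s, y)) := by fun_prop
    obtain ⟨η, hη, hh⟩ := Metric.eventually_nhds_iff.1
      ((hc.tendsto x).eventually (gt_mem_nhds hlt))
    have hs : 0 < min (η / 2) (R - x) := lt_min (by linarith) (by linarith)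
    have hs1 := min_le_left (η / 2) (R - x)
    have hs2 := min_le_right (η / 2) (R - x)
    set s := min (η / 2) (R - x)
    have h1 := hh (y := x + s) (by
      rw [Real.dist_eq, add_sub_cancel_left, abs_of_pos hs]; linarith)
    have h2 := ga y x (x + s) hy1 hx1 (by linarith)
    have h3 := hmax (a := (x + s, y))
      ⟨⟨⟨by simp only; linarith, by simp only; linarith⟩, ⟨hy1, hy2⟩⟩, h1.le, h2.trans hgm⟩
    simp only [mem_ofPred_eq] at h3
    linarith
  · by_contra hne
    have hlt : g (x, y) < 0 := lt_of_le_of_ne hgm hne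
    have hc : Continuous (fun s => g (x, s)) := by fun_prop
    obtain ⟨η, hη, hh⟩ := Metric.eventually_nhds_iff.1
      ((hc.tendsto y).eventually (gt_mem_nhds hlt))
    have hs : 0 < min (η / 2) (R - y) := lt_min (by linarith) (by linarith)
    have hs1 := min_le_left (η / 2) (R - y)
    have hs2 := min_le_right (η / 2) (R - y)
    set s := min (η / 2) (R - y)
    have h1 := hh (y := y + s) (by
      rw [Real.dist_eq, add_sub_cancel_left, abs_of_pos hs]; linarith)
    have h2 := fa x y (y + s) hx1 hy1 (by linarith)
    have h3 := hmax (a := (x, y + s))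
      ⟨⟨⟨hx1, hx2⟩, ⟨by simp only; linarith, by simp only; linarith⟩⟩, h2.trans hfm, h1.le⟩
    simp only [mem_ofPred_eq] at h3
    linarith

/-- Under (H1)–(H4), the averaged map g = (g₁, g₂) has a zero in an open box. -/
theorem g_has_zero
    (ω : ℝ) (hω : 0 < ω)
    (δ₁₁ δ₁₂ δ₂₁ δ₂₂ c₁₁ c₁₂ c₂₁ c₂₂ b₁ b₂ : ℝ → ℝ)
    (hδ₁₁ : NiceCoef ω δ₁₁) (hδ₁₂ : NiceCoef ω δ₁₂)
    (hδ₂₁ : NiceCoef ω δ₂₁) (hδ₂₂ : NiceCoef ω δ₂₂)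
    (hc₁₁ : NiceCoef ω c₁₁) (hc₁₂ : NiceCoef ω c₁₂)
    (hc₂₁ : NiceCoef ω c₂₁) (hc₂₂ : NiceCoef ω c₂₂)
    (hb₁ : NiceCoef ω b₁) (hb₂ : NiceCoef ω b₂)
    (H1 : supC ω b₁ / Real.exp 1 + supC ω δ₁₂ < infC ω δ₁₁)
    (H2 : supC ω b₂ / Real.exp 1 + supC ω δ₂₁ < infC ω δ₂₂)
    (H3 : supC ω δ₁₁ / infC ω c₁₁ - infC ω δ₁₂ / supC ω c₁₂ < infC ω b₁)
    (H4 : supC ω δ₂₂ / infC ω c₂₂ - infC ω δ₂₁ / supC ω c₂₁ < infC ω b₂) :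
    ∃ ε R : ℝ, 0 < ε ∧ ε < R ∧
      ∃ x₁ x₂ : ℝ, x₁ ∈ Ioo ε R ∧ x₂ ∈ Ioo ε R ∧
        gOne ω δ₁₁ δ₁₂ c₁₁ c₁₂ b₁ x₁ x₂ = 0 ∧
        gTwo ω δ₂₁ δ₂₂ c₂₁ c₂₂ b₂ x₁ x₂ = 0 := by
  obtain ⟨ε₁, hε₁, s1⟩ := gOne_small hω hδ₁₁ hδ₁₂ hc₁₁ hc₁₂ hb₁ H3
  obtain ⟨ε₂, hε₂, s2⟩ := gOne_small hω hδ₂₂ hδ₂₁ hc₂₂ hc₂₁ hb₂ H4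
  obtain ⟨R₁, l1⟩ := gOne_large hω hδ₁₁ hδ₁₂ hc₁₁ hc₁₂ hb₁ H1
  obtain ⟨R₂, l2⟩ := gOne_large hω hδ₂₂ hδ₂₁ hc₂₂ hc₂₁ hb₂ H2
  obtain ⟨ε, hε0, hε⟩ := exists_between (lt_min hε₁ hε₂)
  obtain ⟨R, hR⟩ := exists_gt (max ε (max R₁ R₂))
  obtain ⟨hRε, hR'⟩ := max_lt_iff.1 hR
  obtain ⟨hR1, hR2⟩ := max_lt_iff.1 hR'
  obtain ⟨he1, he2⟩ := lt_min_iff.1 hε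
  have hR0 : 0 < R := hε0.trans hRε
  obtain ⟨x, y, hx1, hx2, hy1, hy2, hf, hg⟩ := quasimonotone_zero
    (fun p => gOne ω δ₁₁ δ₁₂ c₁₁ c₁₂ b₁ |p.1| |p.2|)
    (fun p => gOne ω δ₂₂ δ₂₁ c₂₂ c₂₁ b₂ |p.2| |p.1|)
    (gOne_cont hδ₁₁ hδ₁₂ hc₁₁ hc₁₂ hb₁)
    ((gOne_cont hδ₂₂ hδ₂₁ hc₂₂ hc₂₁ hb₂).comp continuous_swap) ε R hRε
    (by
      intro x y z hx hy hyz
      have h1 : |y| ≤ |z| := abs_le_abs_of_nonneg (by linarith) hyz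
      exact gOne_anti hω hδ₁₁ hδ₁₂ hc₁₁ hc₁₂ hb₁ (abs_nonneg _) (abs_nonneg _) h1)
    (by
      intro x y z hx hy hyz
      have h1 : |y| ≤ |z| := abs_le_abs_of_nonneg (by linarith) hyz
      exact gOne_anti hω hδ₂₂ hδ₂₁ hc₂₂ hc₂₁ hb₂ (abs_nonneg _) (abs_nonneg _) h1)
    (by simp only [abs_of_pos hε0]; exact (s1 ε hε0 he1).le)
    (by simp only [abs_of_pos hε0]; exact (s2 ε hε0 he2).le)
    (by intro y _; simp only [abs_of_pos hR0]; exact l1 R _ hR0 hR1 (abs_nonneg _))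
    (by intro y _; simp only [abs_of_pos hR0]; exact l2 R _ hR0 hR2 (abs_nonneg _))
  have hx0 : 0 < x := by linarith
  have hy0 : 0 < y := by linarith
  simp only [abs_of_pos hx0, abs_of_pos hy0] at hf hg
  exact ⟨ε / 2, R, by linarith, by linarith, x, y, ⟨by linarith, hx2⟩, ⟨by linarith, hy2⟩, hf, hg⟩
end
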